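/- arXiv:2311.14259 — 2 statements merged into one kernel-verified Lean document; each statement's English description precedes it below -/
import Mathlib

section
/- In the starlike tree S(A_1, A_2, ..., A_k), denote by v_{i0} the central vertex and by v_{i0} v_{i1} ⋯ v_{i A_i} the i-th pendent path. Then for every 1 ≤ i ≤ k and 0 ≤ j ≤ A_i, the transmission satisfies Tr(v_{ij}) = Tr(v_{i0}) + j·(n - 2·A_i + j - 1), where n = 1 + A_1 + ... + A_k is the order of the tree. -/
/-- The transmission of a vertex: sum of distances to all other vertices. -/
noncomputable def transmission {V : Type*} [Fintype V] (G : SimpleGraph V) (u : V) : ℕ :=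
  ∑ v : V, G.dist u v

/-- A graph is transmission irregular if all vertices have distinct transmissions. -/
def TransmissionIrregular {V : Type*} [Fintype V] (G : SimpleGraph V) : Prop :=
  Function.Injective (transmission G)

/-- The starlike tree `S(A 0, …, A (k-1))`: a central vertex (`none`) with `k`
pendent paths attached, the `i`-th of length `A i`; `some ⟨i, j⟩` is the
`(j+1)`-st vertex on the `i`-th pendent path. -/
def starlikeTree (k : ℕ) (A : Fin k → ℕ) :
    SimpleGraph (Option ((i : Fin k) × Fin (A i))) :=
  SimpleGraph.fromRel (fun x y =>
    match x, y with
    | none, some ⟨_, j⟩ => j.val = 0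
    | some ⟨i, j⟩, some ⟨i', j'⟩ => i.val = i'.val ∧ j.val + 1 = j'.val
    | _, _ => False)

/-- The vertex `v_{ij}` of the starlike tree: the central vertex when `j = 0`,
and the `j`-th vertex of the `i`-th pendent path when `1 ≤ j ≤ A i`. -/
def starVert (k : ℕ) (A : Fin k → ℕ) (i : Fin k) (j : ℕ) (hj : j ≤ A i) :
    Option ((i : Fin k) × Fin (A i)) :=
  if h : j = 0 then none else some ⟨i, ⟨j - 1, by omega⟩⟩

/-- A function vanishing at `u`, growing by at most one along edges, and dropping by one at some
neighbour of every vertex other than `u`, is the distance from `u`. -/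
theorem SimpleGraph.dist_eq_of_descent {V : Type*} (G : SimpleGraph V) (u : V) (f : V → ℕ)
    (h0 : f u = 0) (hadj : ∀ x y, G.Adj x y → f y ≤ f x + 1)
    (hdesc : ∀ v, v ≠ u → ∃ w, G.Adj w v ∧ f w + 1 = f v) (v : V) :
    G.dist u v = f v := by
  have hwalk : ∀ m v, f v = m → ∃ p : G.Walk u v, p.length = m := by
    intro m
    induction m with
    | zero =>
      intro v hv
      by_cases h : v = u
      · subst h
        exact ⟨SimpleGraph.Walk.nil, rfl⟩
      · obtain ⟨w, -, hw⟩ := hdesc v h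
        omega
    | succ m ih =>
      intro v hv
      have h : v ≠ u := by
        rintro rfl
        omega
      obtain ⟨w, hwv, hw⟩ := hdesc v h
      obtain ⟨p, hp⟩ := ih w (by omega)
      exact ⟨p.concat hwv, by simp [hp]⟩
  have hlip : ∀ {x y : V} (p : G.Walk x y), f y ≤ f x + p.length := by
    intro x y p
    induction p with
    | nil => simp
    | cons h p ih =>
      have := hadj _ _ h
      rw [SimpleGraph.Walk.length_cons]
      omega
  obtain ⟨p, hp⟩ := hwalk _ v rfl
  obtain ⟨q, hq⟩ := p.reachable.exists_walk_length_eq_dist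
  have h1 := SimpleGraph.dist_le p
  have h2 := hlip q
  omega

theorem starlikeTree_adj_none_some {k : ℕ} {A : Fin k → ℕ} {i : Fin k} {a : Fin (A i)} :
    (starlikeTree k A).Adj none (some ⟨i, a⟩) ↔ a.val = 0 := by
  simp [starlikeTree]

theorem starlikeTree_adj_some_some {k : ℕ} {A : Fin k → ℕ} {i i' : Fin k} {a : Fin (A i)}
    {b : Fin (A i')} :
    (starlikeTree k A).Adj (some ⟨i, a⟩) (some ⟨i', b⟩) ↔
      i = i' ∧ (a.val + 1 = b.val ∨ b.val + 1 = a.val) := by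
  simp only [starlikeTree, SimpleGraph.fromRel_adj, Fin.val_inj]
  constructor
  · rintro ⟨-, ⟨h, h'⟩ | ⟨h, h'⟩⟩
    · exact ⟨h, Or.inl h'⟩
    · exact ⟨h.symm, Or.inr h'⟩
  · rintro ⟨rfl, h⟩
    refine ⟨?_, by simpa using h⟩
    intro he
    simp only [Option.some.injEq, Sigma.mk.injEq, heq_eq_eq, true_and] at he
    subst he
    omega

theorem starlikeTree_dist_none {k : ℕ} {A : Fin k → ℕ} (v : Option ((i : Fin k) × Fin (A i))) :
    (starlikeTree k A).dist none v = v.elim 0 (fun p => p.2.val + 1) := by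
  refine SimpleGraph.dist_eq_of_descent _ none (fun v => v.elim 0 (fun p => p.2.val + 1)) rfl ?_ ?_ v
  · rintro (_ | ⟨i, a⟩) (_ | ⟨i', b⟩) h
    · simp
    · simp [starlikeTree_adj_none_some.1 h]
    · simp
    · have := (starlikeTree_adj_some_some.1 h).2
      simp only [Option.elim_some]
      omega
  · rintro (_ | ⟨i, ⟨_ | b, hb⟩⟩) hv
    · exact absurd rfl hv
    · exact ⟨none, starlikeTree_adj_none_some.2 rfl, rfl⟩
    · exact ⟨some ⟨i, ⟨b, by omega⟩⟩, starlikeTree_adj_some_some.2 ⟨rfl, Or.inl rfl⟩, rfl⟩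

theorem starlikeTree_dist_some {k : ℕ} {A : Fin k → ℕ} (i : Fin k) (a : Fin (A i))
    (v : Option ((i : Fin k) × Fin (A i))) :
    (starlikeTree k A).dist (some ⟨i, a⟩) v = v.elim (a.val + 1) (fun p =>
      if p.1 = i then (a.val - p.2.val) + (p.2.val - a.val) else a.val + 1 + (p.2.val + 1)) := by
  refine SimpleGraph.dist_eq_of_descent _ (some ⟨i, a⟩) (fun v => v.elim (a.val + 1) (fun p =>
    if p.1 = i then (a.val - p.2.val) + (p.2.val - a.val) else a.val + 1 + (p.2.val + 1)))
    (by simp) ?_ ?_ v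
  · rintro (_ | ⟨i₁, b⟩) (_ | ⟨i₂, c⟩) h
    · exact absurd rfl h.ne
    · have := starlikeTree_adj_none_some.1 h
      simp only [Option.elim_some, Option.elim_none]
      split_ifs <;> omega
    · have := starlikeTree_adj_none_some.1 h.symm
      simp only [Option.elim_some, Option.elim_none]
      split_ifs <;> omega
    · obtain ⟨rfl, h'⟩ := starlikeTree_adj_some_some.1 h
      simp only [Option.elim_some]
      split_ifs <;> omega
  · rintro (_ | ⟨i', b⟩) hv
    · refine ⟨some ⟨i, ⟨0, a.pos⟩⟩, (starlikeTree_adj_none_some.2 rfl).symm, ?_⟩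
      simp
    · by_cases hi : i' = i
      · subst hi
        have hab : b.val ≠ a.val := fun h => hv (by rw [Fin.ext h])
        rcases Nat.lt_or_gt_of_ne hab with h | h
        · refine ⟨some ⟨i', ⟨b.val + 1, by omega⟩⟩,
            starlikeTree_adj_some_some.2 ⟨rfl, Or.inr rfl⟩, ?_⟩
          simp only [Option.elim_some, if_true]
          omega
        · refine ⟨some ⟨i', ⟨b.val - 1, by omega⟩⟩,
            starlikeTree_adj_some_some.2 ⟨rfl, Or.inl (Nat.sub_add_cancel (by omega))⟩, ?_⟩
          simp only [Option.elim_some, if_true]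
          omega
      · obtain ⟨_ | b, hb⟩ := b
        · exact ⟨none, starlikeTree_adj_none_some.2 rfl, by simp [hi]⟩
        · exact ⟨some ⟨i', ⟨b, by omega⟩⟩, starlikeTree_adj_some_some.2 ⟨rfl, Or.inl rfl⟩,
            by simp [hi]; omega⟩

/-- On a path, the total change in distance when moving the base point from just before vertex `0`
to vertex `a`. -/
theorem sum_range_path_dist_sub (a m : ℕ) (h : a ≤ m) :
    ∑ b ∈ Finset.range m, ((((a - b) + (b - a) : ℕ) : ℤ) - (b + 1)) = (a + 1) * (a - m) := by
  have hlow : ∀ l ≤ a, ∑ b ∈ Finset.range l, ((((a - b) + (b - a) : ℕ) : ℤ) - (b + 1))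
      = l * (a - l) := by
    intro l
    induction l with
    | zero => simp
    | succ l ih =>
      intro hl
      rw [Finset.sum_range_succ, ih (by omega)]
      have : (((a - l) + (l - a) : ℕ) : ℤ) = a - l := by omega
      rw [this]
      push_cast
      ring
  induction m, h using Nat.le_induction with
  | base => simpa using hlow a le_rfl
  | succ m hm ih =>
    rw [Finset.sum_range_succ, ih]
    have : (((a - m) + (m - a) : ℕ) : ℤ) = m - a := by omega
    rw [this]
    push_cast
    ring

/-- In the starlike tree `S(A₁, …, A_k)` of order `n = 1 + A₁ + ⋯ + A_k`, for every
`1 ≤ i ≤ k` and `0 ≤ j ≤ A_i`, one has `Tr(v_{ij}) = Tr(v_{i0}) + j(n - 2A_i + j - 1)`. -/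
theorem starlike_transmission_formula (k : ℕ) (hk : 3 ≤ k)
    (A : Fin k → ℕ) (hA : ∀ i, 0 < A i) (n : ℕ) (hn : n = 1 + ∑ i, A i)
    (i : Fin k) (j : ℕ) (hj : j ≤ A i) :
    (transmission (starlikeTree k A) (starVert k A i j hj) : ℤ)
      = (transmission (starlikeTree k A) (starVert k A i 0 (Nat.zero_le _)) : ℤ)
        + (j : ℤ) * ((n : ℤ) - 2 * (A i : ℤ) + (j : ℤ) - 1) := by
  rcases j with _ | a
  · simp
  have hbranch : ∀ i' : Fin k,
      ∑ b : Fin (A i'), (((if i' = i then (a - b.val) + (b.val - a)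
        else a + 1 + (b.val + 1) : ℕ) : ℤ) - (b.val + 1))
      = (a + 1) * A i' + if i' = i then (a + 1) * ((a : ℤ) - 2 * A i) else 0 := by
    intro i'
    split_ifs with hi
    · subst hi
      rw [Fin.sum_univ_eq_sum_range
        (fun b => ((((a - b) + (b - a) : ℕ) : ℤ) - (b + 1))) (A i'),
        sum_range_path_dist_sub a (A i') (by omega)]
      ring
    · have : ∀ b : Fin (A i'), ((a + 1 + (b.val + 1) : ℕ) : ℤ) - (b.val + 1) = a + 1 := by
        intro b
        push_cast
        ring
      simp only [this, Finset.sum_const, Finset.card_univ, Fintype.card_fin, nsmul_eq_mul]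
      ring
  have hsum := Finset.sum_congr rfl fun i' (_ : i' ∈ Finset.univ) => hbranch i'
  rw [Finset.sum_add_distrib, ← Finset.mul_sum, Finset.sum_ite_eq' Finset.univ i] at hsum
  simp only [Finset.sum_sub_distrib, Finset.mem_univ, if_true] at hsum
  simp only [transmission, starVert, Nat.add_one_ne_zero, dite_true, dite_false,
    Nat.add_sub_cancel, starlikeTree_dist_none, starlikeTree_dist_some, Fintype.sum_option,
    Fintype.sum_sigma, Option.elim_some, Option.elim_none]
  subst hn
  push_cast at hsum ⊢
  linarith
end

section
/- Let C, A_1, ..., A_k, B_1, ..., B_m be positive integers with k, m ≥ 2, A_* = Σ A_i, B_* = Σ B_i, and n = 1 + C + A_* + B_*. Suppose the A_i are mutually distinct, the B_i are mutually distinct, A_i < n/2 for all i, B_i < n/2 for all i, and 1 + A_* > n/2. Define α_{ij} = (n - 1 - A_i - A_j)(A_j - A_i), β_{ij} = (n - 1 - B_i - B_j)(B_j - B_i), γ_i = (n - 1 - A_i - A_*)(A_* - A_i), and δ_{ij} = (n - 1 - A_i - B_j)(B_j - A_i) + C·(A_* - B_*). Then the double starlike tree DS(C; A_1, ..., A_k;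 B_1, ..., B_m) is transmission irregular if and only if all of the following hold: (i) for no 1 ≤ i < j ≤ k does α_{ij} have a positive divisor p > √|α_{ij}| with n + 1 - 2A_i ≤ p + α_{ij}/p ≤ n - 1, n + 1 - 2A_j ≤ p - α_{ij}/p ≤ n - 1, and p + α_{ij}/p ≡ n - 1 (mod 2); (ii) for no 1 ≤ i < j ≤ m does β_{ij} have a positive divisor p > √|β_{ij}| with n + 1 - 2B_i ≤ p + β_{ij}/p ≤ n - 1, n + 1 - 2B_j ≤ p - β_{ij}/p ≤ n - 1, and p + β_{ij}/p ≡ n - 1 (mod 2); (iii) for no 1 ≤ i ≤ k does γ_i have a positive divisor p > √|γ_i| with n + 1 - 2A_i ≤ p + γ_i/p ≤ n - 1, 2A_* - n + 3 ≤ p - γ_i/p ≤ 2A_* + 2C - n + 1, and p + γ_i/p ≡ n - 1 (mod 2); (iv) for no 1 ≤ i ≤ k, 1 ≤ j ≤ m does δ_{ij} have a positive divisor p > √|δ_{ij}| with n + 1 - 2A_i ≤ p + δ_{ij}/p ≤ n - 1, n + 1 - 2B_j ≤ p - δ_{ij}/p ≤ n - 1, and p + δ_{ij}/p ≡ n - 1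 (mod 2). -/
/-- The double starlike tree `DS(C; A; B)`: an internal path `Sum.inl 0, …, Sum.inl C`
of length `C`, with `k` pendent paths of lengths `A i` attached at `Sum.inl 0`
(vertices `Sum.inr (Sum.inl ⟨i, j⟩)`), and `m` pendent paths of lengths `B i`
attached at `Sum.inl C` (vertices `Sum.inr (Sum.inr ⟨i, j⟩)`). -/
def doubleStarlikeTree (C k m : ℕ) (A : Fin k → ℕ) (B : Fin m → ℕ) :
    SimpleGraph (Fin (C + 1) ⊕ ((i : Fin k) × Fin (A i)) ⊕ ((i : Fin m) × Fin (B i))) :=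
  SimpleGraph.fromRel (fun x y =>
    match x, y with
    | Sum.inl c, Sum.inl c' => c.val + 1 = c'.val
    | Sum.inl c, Sum.inr (Sum.inl ⟨_, j⟩) => c.val = 0 ∧ j.val = 0
    | Sum.inl c, Sum.inr (Sum.inr ⟨_, j⟩) => c.val = C ∧ j.val = 0
    | Sum.inr (Sum.inl ⟨i, j⟩), Sum.inr (Sum.inl ⟨i', j'⟩) => i.val = i'.val ∧ j.val + 1 = j'.val
    | Sum.inr (Sum.inr ⟨i, j⟩), Sum.inr (Sum.inr ⟨i', j'⟩) => i.val = i'.val ∧ j.val + 1 = j'.val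
    | _, _ => False)

/-- If every edge entering `S` ends at `b`, then a walk entering `S` is longer than the distance
from `b` to its endpoint. -/
theorem SimpleGraph.Walk.dist_add_one_le_of_cut {V : Type*} {G : SimpleGraph V} {S : V → Prop}
    {b : V} (hcut : ∀ x y, G.Adj x y → ¬ S x → S y → y = b) {x w : V} (p : G.Walk x w)
    (hx : ¬ S x) (hw : S w) : G.dist b w + 1 ≤ p.length := by
  induction p with
  | nil => exact absurd hw hx
  | @cons x y w h p ih =>
    rw [SimpleGraph.Walk.length_cons]
    by_cases hy : S y
    · obtain rfl := hcut _ _ h hx hy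
      have := SimpleGraph.dist_le p
      omega
    · have := ih hy hw
      omega

theorem SimpleGraph.Connected.dist_eq_of_cut {V : Type*} {G : SimpleGraph V} (hG : G.Connected)
    {S : V → Prop} {a b w : V} (hab : G.Adj a b) (ha : ¬ S a)
    (hcut : ∀ x y, G.Adj x y → ¬ S x → S y → y = b) (hw : S w) :
    G.dist a w = G.dist b w + 1 := by
  obtain ⟨p, hp⟩ := hG.exists_walk_length_eq_dist a w
  have h1 := p.dist_add_one_le_of_cut hcut ha hw
  have h2 := hG.dist_triangle (u := a) (v := b) (w := w)
  rw [SimpleGraph.dist_eq_one_iff_adj.mpr hab] at h2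
  omega

/-- Crossing a bridge `ab` into the part `S` changes the transmission by the order of the graph
minus twice the order of `S`. -/
theorem transmission_eq_of_cut {V : Type*} [Fintype V] {G : SimpleGraph V} (hG : G.Connected)
    (S : V → Prop) [DecidablePred S] {a b : V} (hab : G.Adj a b) (ha : ¬ S a) (hb : S b)
    (hcut : ∀ x y, G.Adj x y → ¬ S x → S y → x = a ∧ y = b) :
    (transmission G b : ℤ) =
      transmission G a + Fintype.card V - 2 * ∑ w : V, if S w then (1 : ℤ) else 0 := by
  have key : ∀ w, (G.dist b w : ℤ) = G.dist a w + 1 - 2 * (if S w then (1 : ℤ) else 0) := by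
    intro w
    by_cases hw : S w
    · have := hG.dist_eq_of_cut hab ha (fun x y h hx hy => (hcut x y h hx hy).2) hw
      simp only [hw, if_true]
      omega
    · have := hG.dist_eq_of_cut (S := fun v => ¬ S v) hab.symm (not_not.mpr hb)
        (fun x y h hx hy => (hcut y x h.symm hy (not_not.mp hx)).1) hw
      simp only [hw, if_false]
      omega
  simp only [transmission, Nat.cast_sum, key, Finset.sum_sub_distrib, Finset.sum_add_distrib,
    ← Finset.mul_sum]
  simp

namespace doubleStarlikeTree

variable {C k m : ℕ} {A : Fin k → ℕ} {B : Fin m → ℕ}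

theorem adj_inl {c : ℕ} (h : c + 1 < C + 1) :
    (doubleStarlikeTree C k m A B).Adj (Sum.inl ⟨c, by omega⟩) (Sum.inl ⟨c + 1, h⟩) := by
  simp [doubleStarlikeTree]

theorem adj_inl_left (i : Fin k) (h : 0 < A i) :
    (doubleStarlikeTree C k m A B).Adj (Sum.inl 0) (Sum.inr (Sum.inl ⟨i, ⟨0, h⟩⟩)) := by
  simp [doubleStarlikeTree]

theorem adj_inl_right (i : Fin m) (h : 0 < B i) :
    (doubleStarlikeTree C k m A B).Adj (Sum.inl (Fin.last C)) (Sum.inr (Sum.inr ⟨i, ⟨0, h⟩⟩)) := by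
  simp [doubleStarlikeTree]

theorem adj_left (i : Fin k) {j : ℕ} (h : j + 1 < A i) :
    (doubleStarlikeTree C k m A B).Adj (Sum.inr (Sum.inl ⟨i, ⟨j, by omega⟩⟩))
      (Sum.inr (Sum.inl ⟨i, ⟨j + 1, h⟩⟩)) := by
  simp [doubleStarlikeTree]

theorem adj_right (i : Fin m) {j : ℕ} (h : j + 1 < B i) :
    (doubleStarlikeTree C k m A B).Adj (Sum.inr (Sum.inr ⟨i, ⟨j, by omega⟩⟩))
      (Sum.inr (Sum.inr ⟨i, ⟨j + 1, h⟩⟩)) := by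
  simp [doubleStarlikeTree]

theorem connected : (doubleStarlikeTree C k m A B).Connected := by
  have hc : ∀ (c : ℕ) (h : c < C + 1),
      (doubleStarlikeTree C k m A B).Reachable (Sum.inl 0) (Sum.inl ⟨c, h⟩) := by
    intro c
    induction c with
    | zero => intro h; exact SimpleGraph.Reachable.refl _
    | succ c ih => intro h; exact (ih (by omega)).trans (adj_inl h).reachable
  have ha : ∀ (i : Fin k) (j : ℕ) (h : j < A i),
      (doubleStarlikeTree C k m A B).Reachable (Sum.inl 0) (Sum.inr (Sum.inl ⟨i, ⟨j, h⟩⟩)) := by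
    intro i j
    induction j with
    | zero => intro h; exact (adj_inl_left i h).reachable
    | succ j ih => intro h; exact (ih (by omega)).trans (adj_left i h).reachable
  have hb : ∀ (i : Fin m) (j : ℕ) (h : j < B i),
      (doubleStarlikeTree C k m A B).Reachable (Sum.inl 0) (Sum.inr (Sum.inr ⟨i, ⟨j, h⟩⟩)) := by
    intro i j
    induction j with
    | zero => intro h; exact (hc C (by omega)).trans (adj_inl_right i h).reachable
    | succ j ih => intro h; exact (ih (by omega)).trans (adj_right i h).reachable
  rw [SimpleGraph.connected_iff_exists_forall_reachable]
  refine ⟨Sum.inl 0, ?_⟩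
  rintro (c | ⟨i, j⟩ | ⟨i, j⟩)
  · exact hc c c.2
  · exact ha i j j.2
  · exact hb i j j.2

theorem card_eq :
    Fintype.card (Fin (C + 1) ⊕ ((i : Fin k) × Fin (A i)) ⊕ ((i : Fin m) × Fin (B i))) =
      1 + C + (∑ i, A i) + ∑ i, B i := by
  simp only [Fintype.card_sum, Fintype.card_fin, Fintype.card_sigma]
  ring

theorem sigma_fin_mk_eq_iff {r : ℕ} {L : Fin r → ℕ} {i i' : Fin r} {j : Fin (L i)}
    {j' : Fin (L i')} :
    (⟨i, j⟩ : (i : Fin r) × Fin (L i)) = ⟨i', j'⟩ ↔ i.val = i'.val ∧ j.val = j'.val := by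
  constructor
  · rintro ⟨⟩
    exact ⟨rfl, rfl⟩
  · rintro ⟨hi, hj⟩
    obtain rfl := Fin.ext hi
    obtain rfl := Fin.ext hj
    rfl

theorem sum_ite_le_fin (N j : ℕ) (h : j ≤ N) :
    (∑ x : Fin N, if j ≤ x.val then (1 : ℤ) else 0) = N - j := by
  rw [Fin.sum_univ_eq_sum_range (fun x => if j ≤ x then (1 : ℤ) else 0),
    ← Finset.sum_range_add_sum_Ico _ h, Finset.sum_eq_zero, Finset.sum_congr rfl (g := fun _ => 1)]
  · simp [h]
  · intro x hx
    simp [(Finset.mem_Ico.mp hx).1]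
  · intro x hx
    simp [Finset.mem_range.mp hx]

theorem sum_ite_tail {r : ℕ} (L : Fin r → ℕ) (i : Fin r) (j : ℕ) (h : j ≤ L i) :
    (∑ x : (i : Fin r) × Fin (L i), if x.1 = i ∧ j ≤ x.2.val then (1 : ℤ) else 0) = L i - j := by
  rw [Fintype.sum_sigma, Finset.sum_eq_single i, ← sum_ite_le_fin _ _ h]
  · simp
  · intro i' _ hi
    simp [hi]
  · simp

/-- The vertices of the `i`-th pendent path at `Sum.inl 0` from position `j` on. -/
def leftTail (C : ℕ) (A : Fin k → ℕ) (B : Fin m → ℕ) (i : Fin k) (j : ℕ) :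
    (Fin (C + 1) ⊕ ((i : Fin k) × Fin (A i)) ⊕ ((i : Fin m) × Fin (B i))) → Prop
  | Sum.inr (Sum.inl x) => x.1 = i ∧ j ≤ x.2.val
  | _ => False

/-- The vertices of the `i`-th pendent path at `Sum.inl C` from position `j` on. -/
def rightTail (C : ℕ) (A : Fin k → ℕ) (B : Fin m → ℕ) (i : Fin m) (j : ℕ) :
    (Fin (C + 1) ⊕ ((i : Fin k) × Fin (A i)) ⊕ ((i : Fin m) × Fin (B i))) → Prop
  | Sum.inr (Sum.inr x) => x.1 = i ∧ j ≤ x.2.val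
  | _ => False

/-- The vertices of the internal path from position `c` on, with the pendent paths at its end. -/
def innerTail (C : ℕ) (A : Fin k → ℕ) (B : Fin m → ℕ) (c : ℕ) :
    (Fin (C + 1) ⊕ ((i : Fin k) × Fin (A i)) ⊕ ((i : Fin m) × Fin (B i))) → Prop
  | Sum.inl x => c ≤ x.val
  | Sum.inr (Sum.inl _) => False
  | Sum.inr (Sum.inr _) => True

open Classical in
theorem sum_leftTail (i : Fin k) (j : ℕ) (h : j ≤ A i) :
    (∑ w, if leftTail C A B i j w then (1 : ℤ) else 0) = A i - j := by
  have h₁ x : leftTail C A B i j (Sum.inl x) = False := rfl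
  have h₂ x : leftTail C A B i j (Sum.inr (Sum.inl x)) = (x.1 = i ∧ j ≤ x.2.val) := rfl
  have h₃ x : leftTail C A B i j (Sum.inr (Sum.inr x)) = (False) := rfl
  rw [← sum_ite_tail A i j h]
  simp only [Fintype.sum_sum_type, h₁, h₂, h₃]
  simp [-Finset.sum_boole]

open Classical in
theorem sum_rightTail (i : Fin m) (j : ℕ) (h : j ≤ B i) :
    (∑ w, if rightTail C A B i j w then (1 : ℤ) else 0) = B i - j := by
  have h₁ x : rightTail C A B i j (Sum.inl x) = False := rfl
  have h₂ x : rightTail C A B i j (Sum.inr (Sum.inl x)) = (False) := rfl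
  have h₃ x : rightTail C A B i j (Sum.inr (Sum.inr x)) = (x.1 = i ∧ j ≤ x.2.val) := rfl
  rw [← sum_ite_tail B i j h]
  simp only [Fintype.sum_sum_type, h₁, h₂, h₃]
  simp [-Finset.sum_boole]

open Classical in
theorem sum_innerTail (c : ℕ) (h : c ≤ C + 1) :
    (∑ w, if innerTail C A B c w then (1 : ℤ) else 0) = C + 1 - c + ∑ i, (B i : ℤ) := by
  have := sum_ite_le_fin (C + 1) c h
  push_cast at this
  have h₁ x : innerTail C A B c (Sum.inl x) = (c ≤ x.val) := rfl
  have h₂ x : innerTail C A B c (Sum.inr (Sum.inl x)) = False := rfl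
  have h₃ x : innerTail C A B c (Sum.inr (Sum.inr x)) = True := rfl
  simp only [Fintype.sum_sum_type, h₁, h₂, h₃, ← this]
  simp [-Finset.sum_boole]

theorem transmission_left_zero (i : Fin k) (h : 0 < A i) :
    (transmission (doubleStarlikeTree C k m A B) (Sum.inr (Sum.inl ⟨i, ⟨0, h⟩⟩)) : ℤ) =
      transmission (doubleStarlikeTree C k m A B) (Sum.inl 0) +
        ((1 + C + (∑ i, A i) + ∑ i, B i : ℕ) : ℤ) - 2 * A i := by
  classical
  rw [transmission_eq_of_cut connected (leftTail C A B i 0) (adj_inl_left i h), card_eq,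
    sum_leftTail _ _ (by omega)]
  · simp
  · simp [leftTail]
  · simp [leftTail]
  · rintro (c | ⟨i', j⟩ | ⟨i', j⟩) (d | ⟨i'', j'⟩ | ⟨i'', j'⟩) <;>
      simp only [leftTail, doubleStarlikeTree, SimpleGraph.fromRel_adj, Sum.inl.injEq, Sum.inr.injEq,
        sigma_fin_mk_eq_iff, Fin.ext_iff, Fin.val_zero, reduceCtorEq] <;>
      grind

theorem transmission_left_succ (i : Fin k) {j : ℕ} (h : j + 1 < A i) :
    (transmission (doubleStarlikeTree C k m A B) (Sum.inr (Sum.inl ⟨i, ⟨j + 1, h⟩⟩)) : ℤ) =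
      transmission (doubleStarlikeTree C k m A B) (Sum.inr (Sum.inl ⟨i, ⟨j, by omega⟩⟩)) +
        ((1 + C + (∑ i, A i) + ∑ i, B i : ℕ) : ℤ) - 2 * (A i - (j + 1)) := by
  classical
  rw [transmission_eq_of_cut connected (leftTail C A B i (j + 1)) (adj_left i h), card_eq,
    sum_leftTail _ _ (by omega)]
  · simp
  · simp [leftTail]
  · simp [leftTail]
  · rintro (c | ⟨i', j⟩ | ⟨i', j⟩) (d | ⟨i'', j'⟩ | ⟨i'', j'⟩) <;>
      simp only [leftTail, doubleStarlikeTree, SimpleGraph.fromRel_adj, Sum.inl.injEq, Sum.inr.injEq,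
        sigma_fin_mk_eq_iff, Fin.ext_iff, reduceCtorEq] <;>
      grind

theorem transmission_right_zero (i : Fin m) (h : 0 < B i) :
    (transmission (doubleStarlikeTree C k m A B) (Sum.inr (Sum.inr ⟨i, ⟨0, h⟩⟩)) : ℤ) =
      transmission (doubleStarlikeTree C k m A B) (Sum.inl (Fin.last C)) +
        ((1 + C + (∑ i, A i) + ∑ i, B i : ℕ) : ℤ) - 2 * B i := by
  classical
  rw [transmission_eq_of_cut connected (rightTail C A B i 0) (adj_inl_right i h), card_eq,
    sum_rightTail _ _ (by omega)]
  · simp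
  · simp [rightTail]
  · simp [rightTail]
  · rintro (c | ⟨i', j⟩ | ⟨i', j⟩) (d | ⟨i'', j'⟩ | ⟨i'', j'⟩) <;>
      simp only [rightTail, doubleStarlikeTree, SimpleGraph.fromRel_adj, Sum.inl.injEq, Sum.inr.injEq,
        sigma_fin_mk_eq_iff, Fin.ext_iff, Fin.val_last, reduceCtorEq] <;>
      grind

theorem transmission_right_succ (i : Fin m) {j : ℕ} (h : j + 1 < B i) :
    (transmission (doubleStarlikeTree C k m A B) (Sum.inr (Sum.inr ⟨i, ⟨j + 1, h⟩⟩)) : ℤ) =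
      transmission (doubleStarlikeTree C k m A B) (Sum.inr (Sum.inr ⟨i, ⟨j, by omega⟩⟩)) +
        ((1 + C + (∑ i, A i) + ∑ i, B i : ℕ) : ℤ) - 2 * (B i - (j + 1)) := by
  classical
  rw [transmission_eq_of_cut connected (rightTail C A B i (j + 1)) (adj_right i h), card_eq,
    sum_rightTail _ _ (by omega)]
  · simp
  · simp [rightTail]
  · simp [rightTail]
  · rintro (c | ⟨i', j⟩ | ⟨i', j⟩) (d | ⟨i'', j'⟩ | ⟨i'', j'⟩) <;>
      simp only [rightTail, doubleStarlikeTree, SimpleGraph.fromRel_adj, Sum.inr.injEq,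
        sigma_fin_mk_eq_iff, Fin.ext_iff, reduceCtorEq] <;>
      grind

theorem transmission_inner_succ {c : ℕ} (h : c + 1 < C + 1) :
    (transmission (doubleStarlikeTree C k m A B) (Sum.inl ⟨c + 1, h⟩) : ℤ) =
      transmission (doubleStarlikeTree C k m A B) (Sum.inl ⟨c, by omega⟩) +
        ((1 + C + (∑ i, A i) + ∑ i, B i : ℕ) : ℤ) - 2 * (C - c + ∑ i, (B i : ℤ)) := by
  classical
  rw [transmission_eq_of_cut connected (innerTail C A B (c + 1)) (adj_inl h), card_eq,
    sum_innerTail _ (by omega)]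
  · push_cast; ring
  · simp [innerTail]
  · simp [innerTail]
  · rintro (c | ⟨i', j⟩ | ⟨i', j⟩) (d | ⟨i'', j'⟩ | ⟨i'', j'⟩) <;>
      simp only [innerTail, doubleStarlikeTree, SimpleGraph.fromRel_adj, Sum.inl.injEq,
        Fin.ext_iff, reduceCtorEq] <;>
      grind

theorem transmission_inner {n : ℕ} (hn : n = 1 + C + (∑ i, A i) + ∑ i, B i) (c : Fin (C + 1)) :
    (transmission (doubleStarlikeTree C k m A B) (Sum.inl c) : ℤ) =
      transmission (doubleStarlikeTree C k m A B) (Sum.inl 0) +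
        c.val * (c.val + (2 * (∑ l, (A l : ℤ)) - n + 1)) := by
  obtain ⟨c, h⟩ := c
  induction c with
  | zero => simp
  | succ c ih =>
    rw [transmission_inner_succ h, ih (by omega), ← hn]
    have : (n : ℤ) = 1 + C + (∑ i, (A i : ℤ)) + ∑ i, (B i : ℤ) := by rw [hn]; push_cast; ring
    push_cast
    linear_combination 2 * this

theorem transmission_left {n : ℕ} (hn : n = 1 + C + (∑ i, A i) + ∑ i, B i) (i : Fin k)
    (j : Fin (A i)) :
    (transmission (doubleStarlikeTree C k m A B) (Sum.inr (Sum.inl ⟨i, j⟩)) : ℤ) =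
      transmission (doubleStarlikeTree C k m A B) (Sum.inl 0) +
        (j.val + 1) * ((j.val + 1) + ((n : ℤ) - 1 - 2 * A i)) := by
  obtain ⟨j, h⟩ := j
  induction j with
  | zero => rw [transmission_left_zero i h, ← hn]; push_cast; ring
  | succ j ih => rw [transmission_left_succ i h, ih (by omega), ← hn]; push_cast; ring

theorem transmission_right {n : ℕ} (hn : n = 1 + C + (∑ i, A i) + ∑ i, B i) (i : Fin m)
    (j : Fin (B i)) :
    (transmission (doubleStarlikeTree C k m A B) (Sum.inr (Sum.inr ⟨i, j⟩)) : ℤ) =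
      transmission (doubleStarlikeTree C k m A B) (Sum.inl 0) +
        C * ((∑ l, (A l : ℤ)) - ∑ l, (B l : ℤ)) +
        (j.val + 1) * ((j.val + 1) + ((n : ℤ) - 1 - 2 * B i)) := by
  obtain ⟨j, h⟩ := j
  induction j with
  | zero =>
    have : (n : ℤ) = 1 + C + (∑ i, (A i : ℤ)) + ∑ i, (B i : ℤ) := by rw [hn]; push_cast; ring
    rw [transmission_right_zero i h, transmission_inner hn, ← hn]
    push_cast [Fin.val_last]
    linear_combination (-(C : ℤ)) * this
  | succ j ih => rw [transmission_right_succ i h, ih (by omega), ← hn]; push_cast; ring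

end doubleStarlikeTree

/-- Solutions of `x (x + a) = e + y (y + b)` in a box correspond to factorizations `D = p * q` of
`4 D = a ^ 2 - b ^ 2 + 4 e` through `2 x + a = p + q` and `2 y + b = p - q`. -/
theorem exists_divisor_iff_exists_mul_add_eq {a b e D N lo₁ hi₁ lo₂ hi₂ L M : ℤ}
    (ha : 0 < a + 2) (hb : 0 < b + 2) (haN : a ≡ N [ZMOD 2]) (hbN : b ≡ N [ZMOD 2])
    (hD : 4 * D = a ^ 2 - b ^ 2 + 4 * e) (hlo₁ : lo₁ = a + 2) (hhi₁ : hi₁ = a + 2 * L)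
    (hlo₂ : lo₂ = b + 2) (hhi₂ : hi₂ = b + 2 * M) :
    (∃ p : ℤ, 0 < p ∧ p ∣ D ∧ Real.sqrt |(D : ℝ)| < (p : ℝ) ∧
      (lo₁ ≤ p + D / p ∧ p + D / p ≤ hi₁) ∧ (lo₂ ≤ p - D / p ∧ p - D / p ≤ hi₂) ∧
      p + D / p ≡ N [ZMOD 2]) ↔
    ∃ x y : ℤ, 1 ≤ x ∧ x ≤ L ∧ 1 ≤ y ∧ y ≤ M ∧ x * (x + a) = e + y * (y + b) := by
  subst hlo₁ hhi₁ hlo₂ hhi₂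
  unfold Int.ModEq at *
  constructor
  · rintro ⟨p, hp, ⟨q, rfl⟩, -, h₁, h₂, h₃⟩
    rw [Int.mul_ediv_cancel_left _ hp.ne'] at h₁ h₂ h₃
    obtain ⟨x, hx⟩ : ∃ x, p + q = a + 2 * x := ⟨(p + q - a) / 2, by omega⟩
    obtain ⟨y, hy⟩ : ∃ y, p - q = b + 2 * y := ⟨(p - q - b) / 2, by omega⟩
    refine ⟨x, y, by omega, by omega, by omega, by omega, ?_⟩
    have : (p + q) ^ 2 - (p - q) ^ 2 = 4 * (p * q) := by ring
    rw [hD, hx, hy] at this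
    linarith
  · rintro ⟨x, y, hx, hxL, hy, hyM, h⟩
    obtain ⟨p, hp⟩ : ∃ p, 2 * p = (2 * x + a) + (2 * y + b) :=
      ⟨((2 * x + a) + (2 * y + b)) / 2, by omega⟩
    obtain ⟨q, hq⟩ : ∃ q, p + q = 2 * x + a := ⟨2 * x + a - p, by omega⟩
    have hq' : p - q = 2 * y + b := by omega
    have hp0 : 0 < p := by omega
    have hDpq : D = p * q := by
      have h₁ : (p + q) ^ 2 - (p - q) ^ 2 = 4 * (p * q) := by ring
      rw [hq, hq'] at h₁
      linarith
    refine ⟨p, hp0, ⟨q, hDpq⟩, ?_, ?_⟩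
    · rw [Real.sqrt_lt' (by exact_mod_cast hp0)]
      have habs : |q| < p := abs_lt.mpr ⟨by omega, by omega⟩
      have : |D| < p ^ 2 := by
        rw [hDpq, abs_mul, abs_of_pos hp0, sq]
        exact mul_lt_mul_of_pos_left habs hp0
      exact_mod_cast this
    · rw [hDpq, Int.mul_ediv_cancel_left _ hp0.ne']
      omega

theorem eq_of_mul_add_self_eq {a : ℤ} {x y : ℕ} (ha : 0 ≤ a)
    (h : (x : ℤ) * (x + a) = y * (y + a)) : x = y := by
  have hmul : ((x : ℤ) - y) * (x + y + a) = 0 := by linear_combination h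
  rcases mul_eq_zero.mp hmul with h' | h' <;> omega

theorem exists_fin_add_one_eq {N : ℕ} {x : ℤ} (h₁ : 1 ≤ x) (h₂ : x ≤ N) :
    ∃ j : Fin N, (j.val : ℤ) + 1 = x :=
  ⟨⟨(x - 1).toNat, by omega⟩, by simp only [Int.toNat_of_nonneg (by omega : 0 ≤ x - 1)]; omega⟩

/-- Assuming the `A_i` are mutually distinct, the `B_i` are mutually distinct,
each `A_i < n/2`, each `B_i < n/2`, and `1 + A_* > n/2`, the double starlike tree
`DS(C; A; B)` is transmission irregular if and only if none of the numbers
`α_{ij}`, `β_{ij}`, `γ_i`, `δ_{ij}` has a positive divisor `p` satisfying the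
corresponding conditions. -/
theorem doubleStarlike_TI_iff_no_divisor (C k m : ℕ) (hC : 0 < C)
    (hk : 2 ≤ k) (hm : 2 ≤ m) (A : Fin k → ℕ) (B : Fin m → ℕ)
    (hA : ∀ i, 0 < A i) (hB : ∀ i, 0 < B i)
    (hAB : ∑ i, B i ≤ ∑ i, A i)
    (n : ℕ) (hn : n = 1 + C + (∑ i, A i) + ∑ i, B i)
    (hdistA : Function.Injective A) (hdistB : Function.Injective B)
    (hhalfA : ∀ i, 2 * A i < n) (hhalfB : ∀ i, 2 * B i < n)
    (hhalfStar : n < 2 * (1 + ∑ i, A i))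
    (α : Fin k → Fin k → ℤ) (β : Fin m → Fin m → ℤ)
    (γ : Fin k → ℤ) (δ : Fin k → Fin m → ℤ)
    (hα : ∀ i j, α i j = ((n : ℤ) - 1 - (A i : ℤ) - (A j : ℤ)) * ((A j : ℤ) - (A i : ℤ)))
    (hβ : ∀ i j, β i j = ((n : ℤ) - 1 - (B i : ℤ) - (B j : ℤ)) * ((B j : ℤ) - (B i : ℤ)))
    (hγ : ∀ i, γ i = ((n : ℤ) - 1 - (A i : ℤ) - ∑ l, (A l : ℤ)) * ((∑ l, (A l : ℤ)) - (A i : ℤ)))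
    (hδ : ∀ i j, δ i j = ((n : ℤ) - 1 - (A i : ℤ) - (B j : ℤ)) * ((B j : ℤ) - (A i : ℤ))
        + (C : ℤ) * ((∑ l, (A l : ℤ)) - ∑ l, (B l : ℤ))) :
    TransmissionIrregular (doubleStarlikeTree C k m A B) ↔
      ((∀ i j : Fin k, i < j →
          ¬ ∃ p : ℤ, 0 < p ∧ p ∣ α i j ∧ Real.sqrt |((α i j : ℤ) : ℝ)| < (p : ℝ) ∧
            ((n : ℤ) + 1 - 2 * (A i : ℤ) ≤ p + α i j / p ∧ p + α i j / p ≤ (n : ℤ) - 1) ∧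
            ((n : ℤ) + 1 - 2 * (A j : ℤ) ≤ p - α i j / p ∧ p - α i j / p ≤ (n : ℤ) - 1) ∧
            p + α i j / p ≡ (n : ℤ) - 1 [ZMOD 2]) ∧
       (∀ i j : Fin m, i < j →
          ¬ ∃ p : ℤ, 0 < p ∧ p ∣ β i j ∧ Real.sqrt |((β i j : ℤ) : ℝ)| < (p : ℝ) ∧
            ((n : ℤ) + 1 - 2 * (B i : ℤ) ≤ p + β i j / p ∧ p + β i j / p ≤ (n : ℤ) - 1) ∧
            ((n : ℤ) + 1 - 2 * (B j : ℤ) ≤ p - β i j / p ∧ p - β i j / p ≤ (n : ℤ) - 1) ∧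
            p + β i j / p ≡ (n : ℤ) - 1 [ZMOD 2]) ∧
       (∀ i : Fin k,
          ¬ ∃ p : ℤ, 0 < p ∧ p ∣ γ i ∧ Real.sqrt |((γ i : ℤ) : ℝ)| < (p : ℝ) ∧
            ((n : ℤ) + 1 - 2 * (A i : ℤ) ≤ p + γ i / p ∧ p + γ i / p ≤ (n : ℤ) - 1) ∧
            (2 * (∑ l, (A l : ℤ)) - (n : ℤ) + 3 ≤ p - γ i / p ∧
              p - γ i / p ≤ 2 * (∑ l, (A l : ℤ)) + 2 * (C : ℤ) - (n : ℤ) + 1) ∧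
            p + γ i / p ≡ (n : ℤ) - 1 [ZMOD 2]) ∧
       (∀ (i : Fin k) (j : Fin m),
          ¬ ∃ p : ℤ, 0 < p ∧ p ∣ δ i j ∧ Real.sqrt |((δ i j : ℤ) : ℝ)| < (p : ℝ) ∧
            ((n : ℤ) + 1 - 2 * (A i : ℤ) ≤ p + δ i j / p ∧ p + δ i j / p ≤ (n : ℤ) - 1) ∧
            ((n : ℤ) + 1 - 2 * (B j : ℤ) ≤ p - δ i j / p ∧ p - δ i j / p ≤ (n : ℤ) - 1) ∧
            p + δ i j / p ≡ (n : ℤ) - 1 [ZMOD 2])) := by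
  have hn' : (n : ℤ) = 1 + C + (∑ l, (A l : ℤ)) + ∑ l, (B l : ℤ) := by rw [hn]; push_cast; ring
  have hstar : (n : ℤ) < 2 * (1 + ∑ l, (A l : ℤ)) := by exact_mod_cast hhalfStar
  have hI := doubleStarlikeTree.transmission_inner (A := A) (B := B) hn
  have hL := doubleStarlikeTree.transmission_left (A := A) (B := B) hn
  have hR := doubleStarlikeTree.transmission_right (A := A) (B := B) hn
  have eα i j := exists_divisor_iff_exists_mul_add_eq (D := α i j) (N := n - 1) (e := 0)
    (a := n - 1 - 2 * A i) (b := n - 1 - 2 * A j) (L := A i) (M := A j)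
    (lo₁ := n + 1 - 2 * A i) (hi₁ := n - 1) (lo₂ := n + 1 - 2 * A j) (hi₂ := n - 1)
    (by have := hhalfA i; omega) (by have := hhalfA j; omega)
    (by unfold Int.ModEq; omega) (by unfold Int.ModEq; omega) (by rw [hα]; ring)
    (by ring) (by ring) (by ring) (by ring)
  have eβ i j := exists_divisor_iff_exists_mul_add_eq (D := β i j) (N := n - 1) (e := 0)
    (a := n - 1 - 2 * B i) (b := n - 1 - 2 * B j) (L := B i) (M := B j)
    (lo₁ := n + 1 - 2 * B i) (hi₁ := n - 1) (lo₂ := n + 1 - 2 * B j) (hi₂ := n - 1)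
    (by have := hhalfB i; omega) (by have := hhalfB j; omega)
    (by unfold Int.ModEq; omega) (by unfold Int.ModEq; omega) (by rw [hβ]; ring)
    (by ring) (by ring) (by ring) (by ring)
  have eγ i := exists_divisor_iff_exists_mul_add_eq (D := γ i) (N := n - 1) (e := 0)
    (a := n - 1 - 2 * A i) (b := 2 * (∑ l, (A l : ℤ)) - n + 1) (L := A i) (M := C)
    (lo₁ := n + 1 - 2 * A i) (hi₁ := n - 1) (lo₂ := 2 * (∑ l, (A l : ℤ)) - n + 3)
    (hi₂ := 2 * (∑ l, (A l : ℤ)) + 2 * C - n + 1)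
    (by have := hhalfA i; omega) (by omega)
    (by unfold Int.ModEq; omega) (by unfold Int.ModEq; omega) (by rw [hγ]; ring)
    (by ring) (by ring) (by ring) (by ring)
  have eδ i j := exists_divisor_iff_exists_mul_add_eq (D := δ i j) (N := n - 1)
    (e := C * ((∑ l, (A l : ℤ)) - ∑ l, (B l : ℤ)))
    (a := n - 1 - 2 * A i) (b := n - 1 - 2 * B j) (L := A i) (M := B j)
    (lo₁ := n + 1 - 2 * A i) (hi₁ := n - 1) (lo₂ := n + 1 - 2 * B j) (hi₂ := n - 1)
    (by have := hhalfA i; omega) (by have := hhalfB j; omega)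
    (by unfold Int.ModEq; omega) (by unfold Int.ModEq; omega) (by rw [hδ]; ring)
    (by ring) (by ring) (by ring) (by ring)
  simp only [eα, eβ, eγ, eδ]
  clear eα eβ eγ eδ hα hβ hγ hδ
  constructor
  · intro hTI
    have inj {v w} (h : (transmission (doubleStarlikeTree C k m A B) v : ℤ) =
        transmission (doubleStarlikeTree C k m A B) w) : v = w := hTI (by exact_mod_cast h)
    refine ⟨?_, ?_, ?_, ?_⟩
    · rintro i j hij ⟨x, y, hx, hxL, hy, hyM, h⟩
      obtain ⟨x, rfl⟩ := exists_fin_add_one_eq hx hxL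
      obtain ⟨y, rfl⟩ := exists_fin_add_one_eq hy hyM
      have := inj (v := Sum.inr (Sum.inl ⟨i, x⟩)) (w := Sum.inr (Sum.inl ⟨j, y⟩))
        (by rw [hL, hL]; linarith)
      simp only [Sum.inr.injEq, Sum.inl.injEq, Sigma.mk.injEq] at this
      exact hij.ne this.1
    · rintro i j hij ⟨x, y, hx, hxL, hy, hyM, h⟩
      obtain ⟨x, rfl⟩ := exists_fin_add_one_eq hx hxL
      obtain ⟨y, rfl⟩ := exists_fin_add_one_eq hy hyM
      have := inj (v := Sum.inr (Sum.inr ⟨i, x⟩)) (w := Sum.inr (Sum.inr ⟨j, y⟩))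
        (by rw [hR, hR]; linarith)
      simp only [Sum.inr.injEq, Sigma.mk.injEq] at this
      exact hij.ne this.1
    · rintro i ⟨x, y, hx, hxL, hy, hyM, h⟩
      obtain ⟨x, rfl⟩ := exists_fin_add_one_eq hx hxL
      obtain ⟨y, rfl⟩ := exists_fin_add_one_eq hy hyM
      have := inj (v := Sum.inr (Sum.inl ⟨i, x⟩)) (w := Sum.inl y.succ)
        (by rw [hL, hI y.succ, Fin.val_succ]; push_cast; linarith)
      simp at this
    · rintro i j ⟨x, y, hx, hxL, hy, hyM, h⟩
      obtain ⟨x, rfl⟩ := exists_fin_add_one_eq hx hxL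
      obtain ⟨y, rfl⟩ := exists_fin_add_one_eq hy hyM
      have := inj (v := Sum.inr (Sum.inl ⟨i, x⟩)) (w := Sum.inr (Sum.inr ⟨j, y⟩))
        (by rw [hL, hR]; linarith)
      simp at this
  · rintro ⟨h₁, h₂, h₃, h₄⟩
    have posL i (x : Fin (A i)) :
        (0 : ℤ) < (x.val + 1) * (x.val + 1 + ((n : ℤ) - 1 - 2 * A i)) := by
      have := hhalfA i
      exact mul_pos (by omega) (by omega)
    have posR i (x : Fin (B i)) :
        (0 : ℤ) < (x.val + 1) * (x.val + 1 + ((n : ℤ) - 1 - 2 * B i)) := by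
      have := hhalfB i
      exact mul_pos (by omega) (by omega)
    have nIL c i x : (transmission (doubleStarlikeTree C k m A B) (Sum.inl c) : ℤ) ≠
        transmission (doubleStarlikeTree C k m A B) (Sum.inr (Sum.inl ⟨i, x⟩)) := by
      rw [hI c, hL]
      intro h
      rcases Nat.eq_zero_or_pos c.val with hc | hc
      · have := posL i x
        simp only [hc, Nat.cast_zero, zero_mul] at h
        linarith
      · exact h₃ i ⟨x.val + 1, c.val, by omega, by omega, by omega, by omega, by linarith⟩
    have nIR c i x : (transmission (doubleStarlikeTree C k m A B) (Sum.inl c) : ℤ) ≠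
        transmission (doubleStarlikeTree C k m A B) (Sum.inr (Sum.inr ⟨i, x⟩)) := by
      rw [hI c, hR]
      refine ne_of_lt ?_
      have hpos := posR i x
      have hle : (c.val : ℤ) * (c.val + (2 * (∑ l, (A l : ℤ)) - n + 1)) ≤
          C * (C + (2 * (∑ l, (A l : ℤ)) - n + 1)) :=
        mul_le_mul (by omega) (by omega) (by omega) (by omega)
      have hCv : (C : ℤ) + (2 * (∑ l, (A l : ℤ)) - n + 1) =
        (∑ l, (A l : ℤ)) - ∑ l, (B l : ℤ) := by linarith
      rw [hCv] at hle
      linarith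
    have nLR i x j y :
        (transmission (doubleStarlikeTree C k m A B) (Sum.inr (Sum.inl ⟨i, x⟩)) : ℤ) ≠
          transmission (doubleStarlikeTree C k m A B) (Sum.inr (Sum.inr ⟨j, y⟩)) := by
      rw [hL, hR]
      intro h
      exact h₄ i j ⟨x.val + 1, y.val + 1, by omega, by omega, by omega, by omega, by linarith⟩
    intro v w hvw
    replace hvw : (transmission (doubleStarlikeTree C k m A B) v : ℤ) =
      transmission (doubleStarlikeTree C k m A B) w := by exact_mod_cast hvw
    rcases v with c | ⟨i, x⟩ | ⟨i, x⟩ <;> rcases w with d | ⟨j, y⟩ | ⟨j, y⟩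
    · rw [hI c, hI d] at hvw
      congr 1
      exact Fin.ext (eq_of_mul_add_self_eq (a := 2 * (∑ l, (A l : ℤ)) - n + 1) (by omega)
        (by linarith))
    · exact absurd hvw (nIL _ _ _)
    · exact absurd hvw (nIR _ _ _)
    · exact absurd hvw.symm (nIL _ _ _)
    · rw [hL, hL] at hvw
      rcases lt_trichotomy i j with hij | rfl | hij
      · exact absurd ⟨x.val + 1, y.val + 1, by omega, by omega, by omega, by omega,
          by linarith⟩ (h₁ i j hij)
      · have hx := eq_of_mul_add_self_eq (x := x.val + 1) (y := y.val + 1)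
          (a := n - 1 - 2 * A i) (by have := hhalfA i; omega) (by push_cast; linarith)
        obtain rfl : x = y := Fin.ext (by omega)
        rfl
      · exact absurd ⟨y.val + 1, x.val + 1, by omega, by omega, by omega, by omega,
          by linarith⟩ (h₁ j i hij)
    · exact absurd hvw (nLR _ _ _ _)
    · exact absurd hvw.symm (nIR _ _ _)
    · exact absurd hvw.symm (nLR _ _ _ _)
    · rw [hR, hR] at hvw
      rcases lt_trichotomy i j with hij | rfl | hij
      · exact absurd ⟨x.val + 1, y.val + 1, by omega, by omega, by omega, by omega,
          by linarith⟩ (h₂ i j hij)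
      · have hx := eq_of_mul_add_self_eq (x := x.val + 1) (y := y.val + 1)
          (a := n - 1 - 2 * B i) (by have := hhalfB i; omega) (by push_cast; linarith)
        obtain rfl : x = y := Fin.ext (by omega)
        rfl
      · exact absurd ⟨y.val + 1, x.val + 1, by omega, by omega, by omega, by omega,
          by linarith⟩ (h₂ j i hij)
end
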